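/- Let V be a real polynomial of even degree at least 2 with positive leading coefficient, let W be a real polynomial of even degree with positive leading coefficient, set r = deg W − 1, and let τ ≠ 0 be real. Fix n ≥ 1 and write n = pr + q with integers p ≥ 0 and 0 ≤ q < r; set n_j = ⌈n/r⌉ for j = 0, …, q − 1 and n_j = ⌊n/r⌋ for j = q, …, r − 1. Define the weights w_{j,n}(x) = e^{−nV(x)} ∫_ℝ y^j e^{−n(W(y) − τ x y)} dy for j = 0, …, r − 1. Then a monic polynomial P of degree n satisfies the biorthogonality conditions ∬_{ℝ²} P(x) y^k e^{−n(V(x) + W(y) − τ x y)} dx dy = 0 for k = 0, …, n − 1 if and only if it satisfies the multiple orthogonality conditions ∫_ℝ P(x) x^i w_{j,n}(x) dx = 0 for j = 0, …, r − 1 and i = 0, …, n_j − 1. -/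

import Mathlib

open MeasureTheory
open Polynomial Filter Topology Asymptotics

/-- A real polynomial of even degree at least two with positive leading coefficient. -/
structure Confining (U : ℝ[X]) : Prop where
  two_le_natDegree : 2 ≤ U.natDegree
  even_natDegree : Even U.natDegree
  leadingCoeff_pos : 0 < U.leadingCoeff

theorem Confining.comp_neg_X {U : ℝ[X]} (hU : Confining U) : Confining (U.comp (-X)) where
  two_le_natDegree := by simpa [natDegree_comp] using hU.two_le_natDegree
  even_natDegree := by simpa [natDegree_comp] using hU.even_natDegree
  leadingCoeff_pos := by
    rw [leadingCoeff_comp (by simp)]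
    simpa [hU.even_natDegree.neg_one_pow] using hU.leadingCoeff_pos

theorem Confining.sub_of_natDegree_lt {U L : ℝ[X]} (hU : Confining U)
    (h : L.natDegree < U.natDegree) : Confining (U - L) where
  two_le_natDegree := by
    rw [natDegree_sub_eq_left_of_natDegree_lt h]; exact hU.two_le_natDegree
  even_natDegree := by
    rw [natDegree_sub_eq_left_of_natDegree_lt h]; exact hU.even_natDegree
  leadingCoeff_pos := by
    rw [leadingCoeff_sub_of_degree_lt (degree_lt_degree h)]; exact hU.leadingCoeff_pos

theorem Confining.C_mul {U : ℝ[X]} (hU : Confining U) {c : ℝ} (hc : 0 < c) :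
    Confining (C c * U) where
  two_le_natDegree := by rw [natDegree_C_mul hc.ne']; exact hU.two_le_natDegree
  even_natDegree := by rw [natDegree_C_mul hc.ne']; exact hU.even_natDegree
  leadingCoeff_pos := by simpa using mul_pos hc hU.leadingCoeff_pos

theorem Confining.exists_sub_sq {U : ℝ[X]} (hU : Confining U) :
    ∃ ε > 0, Confining (U - C ε * X ^ 2) := by
  rcases hU.two_le_natDegree.lt_or_eq with h | h
  · exact ⟨1, one_pos, hU.sub_of_natDegree_lt (by simpa using h)⟩
  · have hl := hU.leadingCoeff_pos
    refine ⟨U.leadingCoeff / 2, half_pos hl, ?_⟩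
    have hc : (U - C (U.leadingCoeff / 2) * X ^ 2).coeff 2 = U.leadingCoeff / 2 := by
      have : U.coeff 2 = U.leadingCoeff := by rw [leadingCoeff, ← h]
      rw [coeff_sub, coeff_C_mul, coeff_X_pow, if_pos rfl, this]
      ring
    have hd : (U - C (U.leadingCoeff / 2) * X ^ 2).natDegree = 2 := by
      refine natDegree_eq_of_le_of_coeff_ne_zero ?_ (by rw [hc]; positivity)
      refine (natDegree_sub_le _ _).trans (max_le h.ge ?_)
      exact natDegree_C_mul_X_pow_le _ _
    exact ⟨hd.ge, by rw [hd]; exact even_two, by rw [leadingCoeff, hd, hc]; positivity⟩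

theorem confining_of_tendsto {U : ℝ[X]} (h₁ : Tendsto U.eval atTop atTop)
    (h₂ : Tendsto (U.comp (-X)).eval atTop atTop) : Confining U := by
  obtain ⟨hd, hl⟩ := tendsto_atTop_iff_leadingCoeff_nonneg U |>.1 h₁
  obtain ⟨-, hl'⟩ := tendsto_atTop_iff_leadingCoeff_nonneg _ |>.1 h₂
  rw [leadingCoeff_comp (by simp)] at hl'
  have hpos : 0 < U.leadingCoeff :=
    hl.lt_of_ne' (leadingCoeff_ne_zero.2 (ne_zero_of_degree_gt hd))
  have hev : Even U.natDegree := by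
    by_contra ho
    rw [Nat.not_even_iff_odd] at ho
    simp [ho.neg_one_pow] at hl'
    linarith
  have := natDegree_pos_iff_degree_pos.2 hd
  exact ⟨by obtain ⟨k, hk⟩ := hev; omega, hev, hpos⟩

theorem Confining.integrableOn_Ioi_mul_exp_neg {U : ℝ[X]} (hU : Confining U) (R : ℝ[X]) (a : ℝ) :
    IntegrableOn (fun x ↦ R.eval x * Real.exp (-U.eval x)) (Set.Ioi a) := by
  refine integrable_of_isBigO_exp_neg one_pos (by fun_prop) ?_
  have h₁ : Tendsto (fun x ↦ R.eval x / Real.exp x) atTop (𝓝 0) := R.tendsto_div_exp_atTop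
  have hX : (C 2 * X : ℝ[X]).natDegree < U.natDegree :=
    (natDegree_C_mul_X _ two_ne_zero).trans_lt hU.two_le_natDegree
  have hc := hU.sub_of_natDegree_lt hX
  have h₂ : Tendsto (U - C 2 * X).eval atTop atTop :=
    tendsto_atTop_of_leadingCoeff_nonneg _
      (natDegree_pos_iff_degree_pos.1 (by linarith [hc.two_le_natDegree])) hc.leadingCoeff_pos.le
  have h₃ := (h₁.mul (Real.tendsto_exp_neg_atTop_nhds_zero.comp h₂)).isBigO_one ℝ
  refine (h₃.mul (isBigO_refl (fun x : ℝ ↦ Real.exp (-1 * x)) atTop)).congr (fun x ↦ ?_) (by simp)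
  simp only [Function.comp_apply, eval_sub, eval_mul, eval_C, eval_X, div_eq_mul_inv,
    ← Real.exp_neg, mul_assoc, ← Real.exp_add]
  ring_nf

theorem Confining.integrable_mul_exp_neg {U : ℝ[X]} (hU : Confining U) (R : ℝ[X]) :
    Integrable (fun x ↦ R.eval x * Real.exp (-U.eval x)) := by
  have h₁ := hU.integrableOn_Ioi_mul_exp_neg R 0
  have h₂ := hU.comp_neg_X.integrableOn_Ioi_mul_exp_neg (R.comp (-X)) 0
  rw [← integrableOn_univ, ← Set.Iic_union_Ioi (a := (0 : ℝ))]
  refine IntegrableOn.union ?_ h₁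
  rw [integrableOn_Iic_iff_integrableOn_Iio,
    ← (Measure.measurePreserving_neg volume).integrableOn_comp_preimage
      (Homeomorph.neg ℝ).measurableEmbedding]
  have hs : (Neg.neg ⁻¹' Set.Iio 0 : Set ℝ) = Set.Ioi 0 := by ext; simp
  change IntegrableOn _ (Neg.neg ⁻¹' Set.Iio 0) volume
  rw [hs]
  refine h₂.congr_fun (fun x _ ↦ ?_) measurableSet_Ioi
  simp

theorem not_integrable_mul_exp_neg_of_not_tendsto {U R : ℝ[X]}
    (hU : ¬ Tendsto U.eval atTop atTop) (hR : R ≠ 0) :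
    ¬ Integrable (fun x ↦ R.eval x * Real.exp (-U.eval x)) := by
  have hUb : ∃ c, ∀ᶠ x in atTop, U.eval x ≤ c := by
    rcases le_or_gt U.degree 0 with hd | hd
    · exact ⟨U.coeff 0, by rw [eq_C_of_degree_le_zero hd]; simp⟩
    · have : U.leadingCoeff ≤ 0 := by
        by_contra! h
        exact hU (tendsto_atTop_of_leadingCoeff_nonneg U hd h.le)
      exact ⟨0, (tendsto_atBot_of_leadingCoeff_nonpos U hd this).eventually_le_atBot 0⟩
  have hRb : ∃ δ > 0, ∀ᶠ x in atTop, δ ≤ |R.eval x| := by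
    rcases le_or_gt R.degree 0 with hd | hd
    · rw [eq_C_of_degree_le_zero hd] at hR ⊢
      exact ⟨|R.coeff 0|, by simpa using hR, by simp⟩
    · exact ⟨1, one_pos, (abs_tendsto_atTop R hd).eventually_ge_atTop 1⟩
  obtain ⟨c, hc⟩ := hUb
  obtain ⟨δ, hδ, hR'⟩ := hRb
  obtain ⟨a, ha⟩ := eventually_atTop.1 (hc.and hR')
  intro hint
  have hconst : IntegrableOn (fun _ : ℝ ↦ δ * Real.exp (-c)) (Set.Ioi a) := by
    refine Integrable.mono' hint.norm.integrableOn (by fun_prop) ?_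
    filter_upwards [ae_restrict_mem measurableSet_Ioi] with x hx
    obtain ⟨h₁, h₂⟩ := ha x (le_of_lt hx)
    simp only [norm_mul, Real.norm_eq_abs, Real.abs_exp, abs_of_pos hδ]
    exact mul_le_mul h₂ (Real.exp_le_exp.2 (neg_le_neg h₁)) (Real.exp_pos _).le (abs_nonneg _)
  rw [integrableOn_const_iff] at hconst
  simp [hδ.ne'] at hconst

theorem integral_mul_exp_neg_eq_zero_of_not_confining {U : ℝ[X]} (hU : ¬ Confining U) (R : ℝ[X]) :
    ∫ x, R.eval x * Real.exp (-U.eval x) = 0 := by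
  rcases eq_or_ne R 0 with rfl | hR
  · simp
  refine integral_undef fun hint ↦ hU (confining_of_tendsto ?_ ?_)
  · by_contra h
    exact not_integrable_mul_exp_neg_of_not_tendsto h hR hint
  · by_contra h
    refine not_integrable_mul_exp_neg_of_not_tendsto h (R := R.comp (-X)) ?_ ?_
    · simpa [comp_eq_zero_iff] using hR
    · simpa using hint.comp_neg

theorem Confining.sub_linear {U : ℝ[X]} (hU : Confining U) (c : ℝ) : Confining (U - C c * X) :=
  hU.sub_of_natDegree_lt ((show (C c * X).natDegree ≤ 1 by
    simpa using natDegree_C_mul_X_pow_le c 1).trans_lt hU.two_le_natDegree)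

/-- The function `x ↦ ∫ Q(y) e^{-(U(y) - t x y)} dy`. -/
noncomputable def expMoment (U : ℝ[X]) (t : ℝ) (Q : ℝ[X]) (x : ℝ) : ℝ :=
  ∫ y : ℝ, Q.eval y * Real.exp (-(U.eval y - t * x * y))

theorem integrable_expMoment_integrand {U : ℝ[X]} (hU : Confining U) (t : ℝ) (Q : ℝ[X]) (x : ℝ) :
    Integrable (fun y ↦ Q.eval y * Real.exp (-(U.eval y - t * x * y))) := by
  simpa using (hU.sub_linear (t * x)).integrable_mul_exp_neg Q

theorem expMoment_add {U : ℝ[X]} (hU : Confining U) (t : ℝ) (Q₁ Q₂ : ℝ[X]) (x : ℝ) :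
    expMoment U t (Q₁ + Q₂) x = expMoment U t Q₁ x + expMoment U t Q₂ x := by
  simp only [expMoment, eval_add, add_mul]
  exact integral_add (integrable_expMoment_integrand hU t Q₁ x)
    (integrable_expMoment_integrand hU t Q₂ x)

theorem expMoment_smul (U : ℝ[X]) (t c : ℝ) (Q : ℝ[X]) (x : ℝ) :
    expMoment U t (c • Q) x = c * expMoment U t Q x := by
  simp only [expMoment, eval_smul, smul_eq_mul, mul_assoc, integral_const_mul]

/-- The polynomial operator corresponding, under `expMoment U t`, to multiplication by `x`. -/
noncomputable def shiftOp (U : ℝ[X]) (t : ℝ) (Q : ℝ[X]) : ℝ[X] :=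
  t⁻¹ • (Q * derivative U - derivative Q)

theorem degree_shiftOp {U : ℝ[X]} (hU : Confining U) {t : ℝ} (ht : t ≠ 0) {Q : ℝ[X]} {d : ℕ}
    (hQ : Q.degree = d) : (shiftOp U t Q).degree = ↑(d + (U.natDegree - 1)) := by
  have hQ0 : Q ≠ 0 := by rintro rfl; simp at hQ
  have hU2 := hU.two_le_natDegree
  have hdU : (derivative U).degree = ↑(U.natDegree - 1) := degree_derivative (by omega)
  have hm : (Q * derivative U).degree = ↑(d + (U.natDegree - 1)) := by
    rw [degree_mul, hQ, hdU]; norm_cast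
  rw [shiftOp, degree_smul_of_smul_regular _ (IsSMulRegular.of_ne_zero (inv_ne_zero ht)),
    degree_sub_eq_left_of_degree_lt, hm]
  refine (degree_derivative_lt hQ0).trans_le ?_
  rw [hQ, hm]
  exact_mod_cast Nat.le_add_right _ _

theorem expMoment_shiftOp {U : ℝ[X]} (hU : Confining U) {t : ℝ} (ht : t ≠ 0) (Q : ℝ[X]) (x : ℝ) :
    expMoment U t (shiftOp U t Q) x = x * expMoment U t Q x := by
  have hd : ∀ y, HasDerivAt (fun y ↦ Q.eval y * Real.exp (-(U.eval y - t * x * y)))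
      ((derivative Q - Q * derivative U + (t * x) • Q).eval y
        * Real.exp (-(U.eval y - t * x * y))) y := fun y ↦ by
    have h₁ : HasDerivAt (fun y ↦ -(U.eval y - t * x * y)) (-((derivative U).eval y - t * x)) y := by
      refine ((U.hasDerivAt y).sub ((hasDerivAt_id y).const_mul (t * x))).neg.congr_deriv ?_
      simp
    refine ((Q.hasDerivAt y).mul h₁.exp).congr_deriv ?_
    simp only [eval_add, eval_sub, eval_mul, eval_smul, smul_eq_mul]
    ring
  have h₀ : expMoment U t (derivative Q - Q * derivative U + (t * x) • Q) x = 0 :=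
    integral_eq_zero_of_hasDerivAt_of_integrable hd
      (integrable_expMoment_integrand hU t _ x) (integrable_expMoment_integrand hU t _ x)
  have hs : derivative Q - Q * derivative U = (-t) • shiftOp U t Q := by
    rw [shiftOp, smul_smul, neg_mul, mul_inv_cancel₀ ht]
    simp
  rw [expMoment_add hU, hs, expMoment_smul, expMoment_smul] at h₀
  exact mul_left_cancel₀ ht (by linear_combination -h₀)

theorem expMoment_iterate_shiftOp {U : ℝ[X]} (hU : Confining U) {t : ℝ} (ht : t ≠ 0) (Q : ℝ[X])
    (i : ℕ) (x : ℝ) :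
    expMoment U t ((shiftOp U t)^[i] Q) x = x ^ i * expMoment U t Q x := by
  induction i with
  | zero => simp
  | succ i ih =>
    rw [Function.iterate_succ_apply', expMoment_shiftOp hU ht, ih]
    ring

theorem degree_iterate_shiftOp {U : ℝ[X]} (hU : Confining U) {t : ℝ} (ht : t ≠ 0) (i j : ℕ) :
    ((shiftOp U t)^[i] (X ^ j)).degree = ↑(j + i * (U.natDegree - 1)) := by
  induction i with
  | zero => simp
  | succ i ih =>
    rw [Function.iterate_succ_apply', degree_shiftOp hU ht ih]
    congr 1
    ring

/-- The polynomials `(shiftOp U t)^[k / r] (X ^ (k % r))`, `r = U.natDegree - 1`. -/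
noncomputable def shiftSeq {U : ℝ[X]} (hU : Confining U) {t : ℝ} (ht : t ≠ 0) :
    Polynomial.Sequence ℝ where
  elems' k := (shiftOp U t)^[k / (U.natDegree - 1)] (X ^ (k % (U.natDegree - 1)))
  degree_eq' k := by rw [degree_iterate_shiftOp hU ht, Nat.mod_add_div']

theorem stronglyMeasurable_expMoment (U : ℝ[X]) (t : ℝ) (Q : ℝ[X]) :
    StronglyMeasurable (expMoment U t Q) := by
  have h : Continuous (Function.uncurry fun x y : ℝ ↦
      Q.eval y * Real.exp (-(U.eval y - t * x * y))) := by
    unfold Function.uncurry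
    fun_prop
  exact h.stronglyMeasurable.integral_prod_right

theorem abs_expMoment_le {U : ℝ[X]} (hU : Confining U) (h4 : 2 < U.natDegree) (t : ℝ) {ε : ℝ}
    (hε : 0 < ε) (Q : ℝ[X]) :
    ∃ K, ∀ x, |expMoment U t Q x| ≤ K * Real.exp (ε * x ^ 2) := by
  set c := t ^ 2 / (4 * ε) with hc
  have hU' : Confining (U - C c * X ^ 2) :=
    hU.sub_of_natDegree_lt ((natDegree_C_mul_X_pow_le _ _).trans_lt h4)
  have hint := (hU'.integrable_mul_exp_neg Q).abs
  refine ⟨∫ y, |Q.eval y * Real.exp (-(U - C c * X ^ 2).eval y)|, fun x ↦ ?_⟩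
  rw [← integral_mul_const]
  refine abs_integral_le_integral_abs.trans (integral_mono
    (integrable_expMoment_integrand hU t Q x).abs (hint.mul_const _) fun y ↦ ?_)
  simp only [abs_mul, Real.abs_exp, mul_assoc, ← Real.exp_add]
  refine mul_le_mul_of_nonneg_left (Real.exp_le_exp.2 ?_) (abs_nonneg _)
  simp only [eval_sub, eval_mul, eval_C, eval_pow, eval_X]
  have h : c * y ^ 2 + ε * x ^ 2 - t * (x * y) = ε * (x - t / (2 * ε) * y) ^ 2 := by
    rw [hc]
    field_simp
    ring
  nlinarith [mul_nonneg hε.le (sq_nonneg (x - t / (2 * ε) * y))]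

theorem integrable_mul_expMoment_of_two_lt {U V : ℝ[X]} (hU : Confining U) (h4 : 2 < U.natDegree)
    (hV : Confining V) (t : ℝ) (P Q : ℝ[X]) :
    Integrable (fun x ↦ P.eval x * Real.exp (-V.eval x) * expMoment U t Q x) := by
  obtain ⟨ε, hε, hV'⟩ := hV.exists_sub_sq
  obtain ⟨K, hK⟩ := abs_expMoment_le hU h4 t hε Q
  refine ((hV'.integrable_mul_exp_neg P).norm.mul_const K).mono'
    ((by fun_prop : Continuous fun x ↦ P.eval x * Real.exp (-V.eval x)).aestronglyMeasurable.mul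
      (stronglyMeasurable_expMoment U t Q).aestronglyMeasurable) (.of_forall fun x ↦ ?_)
  have h : Real.exp (-(V - C ε * X ^ 2).eval x) =
      Real.exp (-V.eval x) * Real.exp (ε * x ^ 2) := by
    rw [← Real.exp_add]
    congr 1
    simp
    ring
  simp only [norm_mul, Real.norm_eq_abs, Real.abs_exp]
  rw [h, mul_assoc, mul_assoc, mul_assoc]
  refine mul_le_mul_of_nonneg_left (mul_le_mul_of_nonneg_left ?_ (Real.exp_pos _).le) (abs_nonneg _)
  rw [mul_comm]
  exact hK x

theorem expMoment_one_of_natDegree_eq_two {U : ℝ[X]} (hU : Confining U) (h2 : U.natDegree = 2)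
    (t : ℝ) : ∃ (K : ℝ) (S : ℝ[X]), ∀ x, expMoment U t 1 x = K * Real.exp (S.eval x) := by
  have ha : U.coeff 2 ≠ 0 := by
    have := hU.leadingCoeff_pos.ne'
    rwa [leadingCoeff, h2] at this
  set a := U.coeff 2
  set b := U.coeff 1
  set c := U.coeff 0
  refine ⟨√(Real.pi / a), C (4 * a)⁻¹ * (C t * X - C b) ^ 2 - C c, fun x ↦ ?_⟩
  rw [← integral_gaussian, ← integral_sub_right_eq_self _ ((t * x - b) / (2 * a)),
    ← integral_mul_const, expMoment]
  refine integral_congr_ae (.of_forall fun y ↦ ?_)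
  have hU' : U.eval y = c + b * y + a * y ^ 2 := by
    rw [eval_eq_sum_range, h2]
    simp [Finset.sum_range_succ, a, b, c]
  simp only [eval_one, one_mul, ← Real.exp_add, hU', eval_sub, eval_mul, eval_C, eval_pow, eval_X]
  congr 1
  field_simp
  ring

theorem exists_expMoment_eq_mul_of_natDegree_eq_two {U : ℝ[X]} (hU : Confining U)
    (h2 : U.natDegree = 2) {t : ℝ} (ht : t ≠ 0) (Q : ℝ[X]) :
    ∃ R : ℝ[X], ∀ x, expMoment U t Q x = R.eval x * expMoment U t 1 x := by
  have hQ : Q ∈ Submodule.span ℝ (Set.range (shiftSeq hU ht)) := by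
    rw [Polynomial.Sequence.span _ fun i ↦ (leadingCoeff_ne_zero.2 (Sequence.ne_zero _ i)).isUnit]
    trivial
  induction hQ using Submodule.span_induction with
  | mem Q h =>
    obtain ⟨k, rfl⟩ := h
    refine ⟨X ^ k, fun x ↦ ?_⟩
    have hk : shiftSeq hU ht k = (shiftOp U t)^[k] 1 := by
      change (shiftOp U t)^[k / (U.natDegree - 1)] (X ^ (k % (U.natDegree - 1))) = _
      simp [h2, Nat.mod_one]
    rw [hk, expMoment_iterate_shiftOp hU ht]
    simp
  | zero => exact ⟨0, fun x ↦ by simp [expMoment]⟩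
  | add Q₁ Q₂ _ _ h₁ h₂ =>
    obtain ⟨R₁, h₁⟩ := h₁
    obtain ⟨R₂, h₂⟩ := h₂
    exact ⟨R₁ + R₂, fun x ↦ by rw [expMoment_add hU, h₁, h₂, eval_add, add_mul]⟩
  | smul c Q _ h =>
    obtain ⟨R, h⟩ := h
    exact ⟨c • R, fun x ↦ by rw [expMoment_smul, h, eval_smul, smul_eq_mul, mul_assoc]⟩

theorem integrable_or_integral_eq_zero {U V : ℝ[X]} (hU : Confining U) (hV : Confining V)
    {t : ℝ} (ht : t ≠ 0) (P : ℝ[X]) :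
    (∀ Q, Integrable fun x ↦ P.eval x * Real.exp (-V.eval x) * expMoment U t Q x) ∨
      ∀ Q, ∫ x, P.eval x * Real.exp (-V.eval x) * expMoment U t Q x = 0 := by
  rcases hU.two_le_natDegree.lt_or_eq with h4 | h2
  · exact .inl (integrable_mul_expMoment_of_two_lt hU h4 hV t P)
  obtain ⟨K, S, hS⟩ := expMoment_one_of_natDegree_eq_two hU h2.symm t
  have key (Q : ℝ[X]) : ∃ R : ℝ[X],
      (fun x ↦ P.eval x * Real.exp (-V.eval x) * expMoment U t Q x) =
        fun x ↦ R.eval x * Real.exp (-(V - S).eval x) := by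
    obtain ⟨R, hR⟩ := exists_expMoment_eq_mul_of_natDegree_eq_two hU h2.symm ht Q
    refine ⟨C K * P * R, funext fun x ↦ ?_⟩
    rw [hR, hS, eval_sub, neg_sub, sub_eq_neg_add, Real.exp_add]
    simp only [eval_mul, eval_C]
    ring
  by_cases hVS : Confining (V - S)
  · refine .inl fun Q ↦ ?_
    obtain ⟨R, hR⟩ := key Q
    exact hR ▸ hVS.integrable_mul_exp_neg R
  · refine .inr fun Q ↦ ?_
    obtain ⟨R, hR⟩ := key Q
    exact hR ▸ integral_mul_exp_neg_eq_zero_of_not_confining hVS R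

theorem exists_linearMap_eq_integral {U V : ℝ[X]} (hU : Confining U) (hV : Confining V)
    {t : ℝ} (ht : t ≠ 0) (P : ℝ[X]) :
    ∃ L : ℝ[X] →ₗ[ℝ] ℝ, ∀ Q,
      L Q = ∫ x, P.eval x * Real.exp (-V.eval x) * expMoment U t Q x := by
  rcases integrable_or_integral_eq_zero hU hV ht P with h | h
  · refine ⟨⟨⟨_, fun Q₁ Q₂ ↦ ?_⟩, fun c Q ↦ ?_⟩, fun Q ↦ rfl⟩
    · simp only [expMoment_add hU, mul_add]
      exact integral_add (h Q₁) (h Q₂)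
    · simp only [expMoment_smul, mul_left_comm _ c, integral_const_mul]
      rfl
  · exact ⟨0, fun Q ↦ (h Q).symm⟩

theorem Polynomial.Sequence.forall_lt_map_eq_zero_iff (S : Polynomial.Sequence ℝ)
    (L : ℝ[X] →ₗ[ℝ] ℝ) (n : ℕ) :
    (∀ k < n, L (S k) = 0) ↔ degreeLT ℝ n ≤ LinearMap.ker L := by
  rw [← S.span_degreeLT fun i _ ↦ (leadingCoeff_ne_zero.2 (S.ne_zero i)).isUnit,
    Submodule.span_le]
  simp [Set.subset_def]

theorem forall_lt_integral_eq_zero_iff {U V : ℝ[X]} (hU : Confining U) (hV : Confining V)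
    {t : ℝ} (ht : t ≠ 0) (P : ℝ[X]) (n : ℕ) :
    (∀ k < n, ∫ x, P.eval x * Real.exp (-V.eval x) * expMoment U t (X ^ k) x = 0) ↔
      ∀ k < n, ∫ x, P.eval x * Real.exp (-V.eval x) * (x ^ (k / (U.natDegree - 1)) *
        expMoment U t (X ^ (k % (U.natDegree - 1))) x) = 0 := by
  obtain ⟨L, hL⟩ := exists_linearMap_eq_integral hU hV ht P
  simp only [← expMoment_iterate_shiftOp hU ht, ← hL]
  exact (Sequence.forall_lt_map_eq_zero_iff ⟨fun k ↦ X ^ k, by simp⟩ L n).trans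
    (Sequence.forall_lt_map_eq_zero_iff (shiftSeq hU ht) L n).symm

theorem lt_ite_ceilDiv_iff {r p q i j : ℕ} (hq : q < r) (hj : j < r) :
    (i < if j < q then (p * r + q + r - 1) / r else (p * r + q) / r) ↔ i * r + j < p * r + q := by
  have hr : 0 < r := by omega
  split_ifs with h
  · rw [Nat.lt_iff_add_one_le, Nat.le_div_iff_mul_le hr]
    constructor
    · intro H
      have : i ≤ p := by
        by_contra! hip
        nlinarith [Nat.mul_le_mul_right r (show p + 1 ≤ i from hip),
          show (i + 1) * r ≤ p * r + q + r from H.trans (by omega)]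
      nlinarith [Nat.mul_le_mul_right r this]
    · intro H
      rw [add_mul]
      have : i * r ≤ p * r := by
        refine Nat.mul_le_mul_right r ?_
        by_contra! hip
        nlinarith [Nat.mul_le_mul_right r (show p + 1 ≤ i from hip)]
      omega
  · have : (p * r + q) / r = p := by
      rw [mul_comm, Nat.mul_add_div hr, Nat.div_eq_of_lt hq, add_zero]
    rw [this]
    constructor
    · intro H
      nlinarith [Nat.mul_le_mul_right r (show i + 1 ≤ p from H)]
    · intro H
      by_contra! hip
      nlinarith [Nat.mul_le_mul_right r hip]

/-- In the two matrix model with potentials `V`, `W` and coupling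
`τ ≠ 0`, a monic polynomial `P` of degree `n` satisfies the biorthogonality
conditions `∬ P(x) y^k e^{-n(V(x)+W(y)-τxy)} dx dy = 0` for `k = 0, …, n-1`
if and only if it satisfies the multiple orthogonality conditions
`∫ P(x) x^i w_{j,n}(x) dx = 0` for `j = 0, …, r-1`, `i = 0, …, n_j - 1`,
where `r = deg W - 1`, `w_{j,n}(x) = e^{-nV(x)} ∫ y^j e^{-n(W(y)-τxy)} dy`,
`n = p r + q` with `0 ≤ q < r`, `n_j = ⌈n/r⌉` for `j < q` and `n_j = ⌊n/r⌋`
for `q ≤ j < r`. -/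
theorem biorthogonality_iff_multiple_orthogonality
    (V W : Polynomial ℝ)
    (hVdeg : Even V.natDegree) (hVdeg2 : 2 ≤ V.natDegree)
    (hVlead : 0 < V.leadingCoeff)
    (hWdeg : Even W.natDegree) (hWlead : 0 < W.leadingCoeff)
    (r : ℕ) (hr : r = W.natDegree - 1)
    (τ : ℝ) (hτ : τ ≠ 0)
    (n : ℕ) (hn1 : 1 ≤ n)
    (p q : ℕ) (hq : q < r) (hpq : n = p * r + q)
    (nIdx : Fin r → ℕ)
    (hnIdx : ∀ j : Fin r,
      nIdx j = if (j : ℕ) < q then (n + r - 1) / r else n / r)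
    (w : Fin r → ℝ → ℝ)
    (hw : ∀ (j : Fin r) (x : ℝ), w j x = Real.exp (-(n : ℝ) * V.eval x) *
      ∫ y : ℝ, y ^ (j : ℕ) * Real.exp (-(n : ℝ) * (W.eval y - τ * x * y)))
    (P : Polynomial ℝ) (hP : P.Monic) (hPdeg : P.natDegree = n) :
    (∀ k < n, ∫ x : ℝ, ∫ y : ℝ,
        P.eval x * y ^ k * Real.exp (-(n : ℝ) * (V.eval x + W.eval y - τ * x * y)) = 0) ↔
      (∀ j : Fin r, ∀ i < nIdx j, ∫ x : ℝ, P.eval x * x ^ i * w j x = 0) := by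
  have hn : (0 : ℝ) < n := by exact_mod_cast hn1
  have hV' : Confining (C (n : ℝ) * V) := (Confining.mk hVdeg2 hVdeg hVlead).C_mul hn
  have hW : Confining W := ⟨by omega, hWdeg, hWlead⟩
  have hW' : Confining (C (n : ℝ) * W) := hW.C_mul hn
  have hr' : (C (n : ℝ) * W).natDegree - 1 = r := by rw [natDegree_C_mul hn.ne', hr]
  have hmom (k : ℕ) (x : ℝ) : expMoment (C (n : ℝ) * W) (n * τ) (X ^ k) x =
      ∫ y : ℝ, y ^ k * Real.exp (-(n : ℝ) * (W.eval y - τ * x * y)) := by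
    refine integral_congr_ae (.of_forall fun y ↦ ?_)
    simp only [eval_pow, eval_X, eval_mul, eval_C]
    ring_nf
  have hexp (x : ℝ) : Real.exp (-(n : ℝ) * V.eval x) = Real.exp (-(C (n : ℝ) * V).eval x) := by
    simp
  have hbi (k : ℕ) (x : ℝ) : ∫ y : ℝ, P.eval x * y ^ k *
      Real.exp (-(n : ℝ) * (V.eval x + W.eval y - τ * x * y)) =
        P.eval x * Real.exp (-(C (n : ℝ) * V).eval x) *
          expMoment (C (n : ℝ) * W) (n * τ) (X ^ k) x := by
    rw [hmom, ← hexp, ← integral_const_mul]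
    refine integral_congr_ae (.of_forall fun y ↦ ?_)
    simp only
    rw [add_sub_assoc, mul_add, Real.exp_add]
    ring
  have hmul (i : ℕ) (j : Fin r) (x : ℝ) : P.eval x * x ^ i * w j x =
      P.eval x * Real.exp (-(C (n : ℝ) * V).eval x) *
        (x ^ i * expMoment (C (n : ℝ) * W) (n * τ) (X ^ (j : ℕ)) x) := by
    rw [hw, hmom, ← hexp]
    ring
  simp only [hbi, hmul]
  rw [forall_lt_integral_eq_zero_iff hW' hV' (mul_ne_zero hn.ne' hτ), hr']
  have hidx (i : ℕ) (j : Fin r) : i < nIdx j ↔ i * r + j < n := by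
    rw [hnIdx, hpq, lt_ite_ceilDiv_iff hq j.2]
  have hrpos : 0 < r := by omega
  constructor
  · intro h j i hi
    have := h (i * r + j) ((hidx i j).1 hi)
    rwa [Nat.mul_add_mod', Nat.mod_eq_of_lt j.2, mul_comm i r, Nat.mul_add_div hrpos, Nat.div_eq_of_lt j.2,
      add_zero] at this
  · intro h k hk
    refine h ⟨k % r, Nat.mod_lt k hrpos⟩ (k / r) ((hidx _ _).2 ?_)
    rwa [Nat.div_add_mod']
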